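/- arXiv:2506.15073 — 3 statements merged into one kernel-verified Lean document; each statement's English description precedes it below -/
import Mathlib

section
/- Let M, N, N_e, R be natural numbers with 1 ≤ M, N ≤ M, N_e ≤ M, and 2M(M − N_e) ≤ R. Then min{ (M − N_e) + (R − 2(M − N_e)M)/(4M), N } (with natural-number floor division) is the greatest natural number δ for which there exist natural numbers f, f_e satisfying: 2δ ≤ (M − N_e) + f + f_e, δ ≤ N, δ ≤ (M − N_e) + f_e, and 2M(f + f_e) ≤ R. (That is, this value is both achievable and optimal.) -/
/-- First row of Table 2 (Corollary 1), case `N ≤ M` and `N_e ≤ M`: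
`min {(M − N_e) + (R − 2(M − N_e)M)/(4M), N}` is the greatest natural number `δ`
feasible for the symmetric instance of Problem (P0₁). -/
theorem table2_row1_isGreatest
    (M N Ne R : ℕ) (hM : 1 ≤ M) (hN : N ≤ M) (hNe : Ne ≤ M)
    (hR : 2 * M * (M - Ne) ≤ R) :
    IsGreatest
      {δ : ℕ | ∃ f fe : ℕ,
        2 * δ ≤ (M - Ne) + f + fe ∧ δ ≤ N ∧ δ ≤ (M - Ne) + fe ∧
        2 * M * (f + fe) ≤ R}
      (min ((M - Ne) + (R - 2 * (M - Ne) * M) / (4 * M)) N) := by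
  generalize M - Ne = a at *
  obtain ⟨S, rfl⟩ := Nat.exists_eq_add_of_le hR
  have e : 2 * M * a + S - 2 * a * M = S := by
    rw [show 2 * a * M = 2 * M * a by ring]
    omega
  rw [e]
  constructor
  · have hq : S / (4 * M) * (4 * M) ≤ S := Nat.div_mul_le_self _ _
    refine ⟨a + S / (4 * M), S / (4 * M), by omega, by omega, by omega, ?_⟩
    nlinarith
  · rintro d ⟨f, fe, h1, h2, -, h4⟩
    refine le_min ?_ h2
    by_cases hd : d ≤ a
    · exact hd.trans (Nat.le_add_right _ _)
    · obtain ⟨k, rfl⟩ := Nat.exists_eq_add_of_le (not_le.mp hd).le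
      have h5 : a + 2 * k ≤ f + fe := by omega
      have h6 := Nat.mul_le_mul_left (2 * M) h5
      have : k ≤ S / (4 * M) := by
        rw [Nat.le_div_iff_mul_le (by omega)]
        nlinarith
      exact Nat.add_le_add_left this a
end

section
/- Let M, N, N_e, R be natural numbers with N ≤ M and M < N_e. Then min{ R/(2(N_e + M)), N } (with natural-number floor division) is the greatest natural number δ for which there exist natural numbers f, f_e satisfying: 2δ ≤ f + f_e, δ ≤ N, δ ≤ f_e, and 2(N_e·f_e + M·f) ≤ R. (That is, this value is both achievable and optimal.) -/
/-- Second row of Table 2 (Corollary 1), case `N ≤ M` and `N_e > M`: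
`min {R/(2(N_e + M)), N}` is the greatest natural number `δ` feasible for the
symmetric instance of Problem (P0₁). -/
theorem table2_row2_isGreatest
    (M N Ne R : ℕ) (hN : N ≤ M) (hNe : M < Ne) :
    IsGreatest
      {δ : ℕ | ∃ f fe : ℕ,
        2 * δ ≤ f + fe ∧ δ ≤ N ∧ δ ≤ fe ∧
        2 * (Ne * fe + M * f) ≤ R}
      (min (R / (2 * (Ne + M))) N) := by
  constructor
  · refine ⟨min (R / (2 * (Ne + M))) N, min (R / (2 * (Ne + M))) N, by omega,
      min_le_right _ _, le_rfl, ?_⟩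
    have h1 : min (R / (2 * (Ne + M))) N ≤ R / (2 * (Ne + M)) := min_le_left _ _
    have h2 := Nat.div_mul_le_self R (2 * (Ne + M))
    have h3 := Nat.mul_le_mul_right (2 * (Ne + M)) h1
    generalize min (R / (2 * (Ne + M))) N = d at *
    calc 2 * (Ne * d + M * d) = d * (2 * (Ne + M)) := by ring
      _ ≤ R := h3.trans h2
  · rintro d ⟨f, fe, h1, h2, h3, h4⟩
    refine le_min ?_ h2
    rw [Nat.le_div_iff_mul_le (by omega)]
    obtain ⟨a, rfl⟩ := Nat.exists_eq_add_of_le h3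
    have h5 : M * d ≤ M * (a + f) := Nat.mul_le_mul_left _ (by omega)
    have h6 : M * a ≤ Ne * a := Nat.mul_le_mul_right _ hNe.le
    nlinarith
end

section
/- Let M, N, N_e, R be natural numbers with M < N and N ≤ N_e. Then for all natural numbers δ, f, f_e satisfying δ ≤ f_e, 2δ ≤ (N − M) + f + f_e, and 2(N_e·f_e + N·f) ≤ R, one has 2(N + N_e)δ ≤ R + 2N(N − M). -/
/-- Converse (optimality) for the fourth row of Table 2 (Corollary 1), case
`N > M` and `N ≤ N_e`: every feasible `(δ, f, f_e)` for the symmetric instance of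
Problem (P0₁) satisfies `2(N + N_e)δ ≤ R + 2N(N − M)`. -/
theorem table2_row4_converse
    (M N Ne R : ℕ) (hMN : M < N) (hNNe : N ≤ Ne) :
    ∀ δ f fe : ℕ,
      δ ≤ fe →
      2 * δ ≤ (N - M) + f + fe →
      2 * (Ne * fe + N * f) ≤ R →
      2 * (N + Ne) * δ ≤ R + 2 * N * (N - M) := by
  intro δ f fe h1 h2 h3
  generalize N - M = k at *
  obtain ⟨d, rfl⟩ := Nat.exists_eq_add_of_le hNNe
  have a := Nat.mul_le_mul_left N h2
  have b := Nat.mul_le_mul_left d h1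
  nlinarith [a, b, h3]
end
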